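/- Let g : ℝ → ℝ be measurable with ∫_ℝ |g(λ)| dλ < ∞ and ∫_ℝ |λ g(λ)| dλ < ∞, set a = (1/(2π))∫_ℝ g(λ) dλ and b = (1/(2π))∫_ℝ λ g(λ) dλ, let u ∈ ℝ, and define for λ in the open lower half plane F(λ) = (1/(2πi)) ∫_ℝ g(s)/(s − λ) ds and π₁(λ) = (λ + 2u + a)·exp(i F(λ)). Then, along λ = −it with t → +∞, lim λ·( π₁(λ) − λ − 2u ) = −2ua − b − a²/2. In particular, if w satisfies 2w = lim_{λ→∞} λ(π₁(λ) − λ − 2u), then w = −u·a − b/2 − a²/4 (the implicit solution of Example 1: ∂_x⁻¹u_y = −u⟨f₁⟩ − ⟨λf₁⟩/2 − ⟨f₁⟩²/4). -/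

import Mathlib

open Filter MeasureTheory Real

lemma aux_im (t : ℝ) : (-Complex.I * t).im = -t := by simp

lemma aux_ne (t : ℝ) (ht : 0 < t) (s : ℝ) : (s : ℂ) - -Complex.I * t ≠ 0 := by
  intro h
  have := congrArg Complex.im h
  simp at this
  linarith

lemma aux_bound (t : ℝ) (ht : 0 < t) (s : ℝ) :
    ‖(-Complex.I * t) / ((s : ℂ) - -Complex.I * t)‖ ≤ 1 := by
  have h0 := norm_pos_iff.mpr (aux_ne t ht s)
  rw [norm_div, div_le_one h0]
  have h1 := Complex.abs_im_le_norm ((s : ℂ) - -Complex.I * t)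
  simp only [Complex.sub_im, aux_im, Complex.ofReal_im] at h1
  calc ‖-Complex.I * (t : ℂ)‖ = |0 - -t| := by simp
    _ ≤ _ := h1

lemma aux_pt (s : ℝ) :
    Tendsto (fun t : ℝ => (-Complex.I * t) / ((s : ℂ) - -Complex.I * t)) atTop (nhds (-1)) := by
  have h1 : Tendsto (fun t : ℝ => ((t⁻¹ : ℝ) : ℂ)) atTop (nhds ((0 : ℝ) : ℂ)) :=
    (Complex.continuous_ofReal.tendsto 0).comp tendsto_inv_atTop_zero
  have h2 : Tendsto (fun t : ℝ => -Complex.I / ((s : ℂ) * ((t⁻¹ : ℝ) : ℂ) + Complex.I)) atTop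
      (nhds (-Complex.I / ((s : ℂ) * ((0 : ℝ) : ℂ) + Complex.I))) := by
    refine Tendsto.div tendsto_const_nhds ((h1.const_mul _).add_const _) ?_
    simp
  have h3 : -Complex.I / ((s : ℂ) * ((0 : ℝ) : ℂ) + Complex.I) = -1 := by
    simp [neg_div]
  rw [h3] at h2
  refine h2.congr' ?_
  filter_upwards [eventually_gt_atTop 0] with t ht
  have ht' : (t : ℂ) ≠ 0 := by exact_mod_cast ht.ne'
  have e : (s : ℂ) - -Complex.I * t = ((s : ℂ) * ((t⁻¹ : ℝ) : ℂ) + Complex.I) * t := by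
    push_cast
    field_simp
    ring
  rw [e, mul_div_mul_right _ _ ht']

lemma aux_meas (h : ℝ → ℝ) (hh : Integrable h) (t : ℝ) :
    AEStronglyMeasurable (fun s : ℝ => (h s : ℂ) / ((s : ℂ) - -Complex.I * t)) := by
  have h1 : Measurable (fun s : ℝ => (((s : ℂ) - -Complex.I * t)⁻¹)) := by fun_prop
  simp only [div_eq_mul_inv]
  exact hh.ofReal.aestronglyMeasurable.mul h1.aestronglyMeasurable

lemma aux_dct (h : ℝ → ℝ) (hh : Integrable h) :
    Tendsto (fun t : ℝ => (-Complex.I * t) * ∫ s : ℝ, (h s : ℂ) / ((s : ℂ) - -Complex.I * t))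
      atTop (nhds (-((∫ s, h s : ℝ) : ℂ))) := by
  have e : -((∫ s, h s : ℝ) : ℂ) = ∫ s, (h s : ℂ) * (-1) := by
    rw [integral_mul_const, integral_complex_ofReal]; ring
  rw [e]
  simp only [← integral_const_mul]
  refine tendsto_integral_filter_of_dominated_convergence (fun s => ‖h s‖) ?_ ?_ hh.norm ?_
  · exact Eventually.of_forall fun t => (aux_meas h hh t).const_mul _
  · filter_upwards [eventually_gt_atTop 0] with t ht
    refine Eventually.of_forall fun s => ?_
    have : (-Complex.I * t) * ((h s : ℂ) / ((s : ℂ) - -Complex.I * t))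
        = (h s : ℂ) * ((-Complex.I * t) / ((s : ℂ) - -Complex.I * t)) := by ring
    rw [this, norm_mul, Complex.norm_real]
    exact mul_le_of_le_one_right (norm_nonneg _) (aux_bound t ht s)
  · refine Eventually.of_forall fun s => ?_
    refine ((aux_pt s).const_mul (h s : ℂ)).congr fun t => ?_
    ring

lemma aux_int (h : ℝ → ℝ) (hh : Integrable h) (t : ℝ) (ht : 0 < t) :
    Integrable (fun s : ℝ => (h s : ℂ) / ((s : ℂ) - -Complex.I * t)) := by
  refine (hh.norm.mul_const t⁻¹).mono' (aux_meas h hh t) (Eventually.of_forall fun s => ?_)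
  have h0 := norm_pos_iff.mpr (aux_ne t ht s)
  have hb := aux_bound t ht s
  rw [norm_div, div_le_one h0] at hb
  have e : ‖-Complex.I * (t : ℂ)‖ = t := by simp [abs_of_pos ht]
  rw [e] at hb
  rw [norm_div, Complex.norm_real, div_eq_mul_inv]
  gcongr

lemma aux_id (g : ℝ → ℝ) (hg : Integrable g) (hsg : Integrable (fun l : ℝ => l * g l))
    (t : ℝ) (ht : 0 < t) :
    (-Complex.I * t) * (∫ s : ℝ, (g s : ℂ) / ((s : ℂ) - -Complex.I * t))
      + ((∫ s, g s : ℝ) : ℂ) =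
      ∫ s : ℝ, ((s * g s : ℝ) : ℂ) / ((s : ℂ) - -Complex.I * t) := by
  have hgc : Integrable (fun s : ℝ => (g s : ℂ)) := hg.ofReal
  rw [← integral_complex_ofReal, ← integral_const_mul,
    ← integral_add ((aux_int g hg t ht).const_mul _) hgc]
  congr 1
  funext s
  have := aux_ne t ht s
  rw [eq_div_iff this, add_mul, mul_assoc, div_mul_cancel₀ _ this]
  push_cast
  ring

lemma aux_exp (z L R : ℝ → ℂ) (a b u : ℂ) (hL : Tendsto (fun t => (L t)⁻¹) atTop (nhds 0))
    (hL0 : ∀ᶠ t in atTop, L t ≠ 0)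
    (h1 : Tendsto (fun t => L t * z t) atTop (nhds (-a)))
    (h2 : Tendsto (fun t => L t * R t) atTop (nhds (-b)))
    (hR : ∀ᶠ t in atTop, L t * z t + a = R t) :
    Tendsto (fun t => L t * ((L t + 2 * u + a) * Complex.exp (z t) - L t - 2 * u)) atTop
      (nhds (-2 * u * a - b - a ^ 2 / 2)) := by
  have hz : Tendsto z atTop (nhds 0) := by
    have := hL.mul h1
    rw [zero_mul] at this
    refine this.congr' ?_
    filter_upwards [hL0] with t ht
    field_simp
  have hE : Tendsto (fun t => L t ^ 2 * (Complex.exp (z t) - (1 + z t + z t ^ 2 / 2)))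
      atTop (nhds 0) := by
    have hb : Tendsto (fun t => ‖L t * z t‖ ^ 2 * (‖z t‖ * Real.exp ‖z t‖)) atTop
        (nhds (‖-a‖ ^ 2 * (‖(0 : ℂ)‖ * Real.exp ‖(0 : ℂ)‖))) :=
      (h1.norm.pow 2).mul (hz.norm.mul ((Real.continuous_exp.tendsto _).comp hz.norm))
    simp only [norm_zero, zero_mul, mul_zero] at hb
    refine squeeze_zero_norm (fun t => ?_) hb
    have := Complex.norm_exp_sub_sum_le_norm_mul_exp (z t) 3
    simp only [Finset.sum_range_succ, Finset.sum_range_zero, Nat.factorial] at this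
    norm_num at this
    rw [norm_mul, norm_mul, norm_pow]
    calc _ ≤ ‖L t‖ ^ 2 * (‖z t‖ ^ 3 * Real.exp ‖z t‖) := by gcongr
      _ = _ := by ring
  have hS := hE.add ((h1.pow 2).div_const 2)
  have key := (hS.add h2).add ((h1.add (hL.mul hS)).const_mul (2 * u + a))
  have e : (-2 * u * a - b - a ^ 2 / 2) = 0 + (-a) ^ 2 / 2 + -b +
      (2 * u + a) * (-a + 0 * (0 + (-a) ^ 2 / 2)) := by ring
  rw [e]
  refine key.congr' ?_
  filter_upwards [hL0, hR] with t ht hr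
  rw [← hr]
  field_simp
  ring

/-- the implicit solution of Example 1. With
`a = ⟨g⟩ = (1/2π)∫ g`, `b = ⟨λg⟩ = (1/2π)∫ λ g(λ) dλ`,
`F(λ) = (1/(2πi)) ∫ g(s)/(s − λ) ds` and `π₁(λ) = (λ + 2u + a) e^{iF(λ)}`, along
`λ = −it`, `t → +∞`, `λ(π₁(λ) − λ − 2u) → −2ua − b − a²/2`; in particular any `w`
with `2w = lim λ(π₁(λ) − λ − 2u)` satisfies `w = −ua − b/2 − a²/4`. -/
theorem example1_implicit_solution
    (g : ℝ → ℝ) (hmeas : Measurable g)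
    (hg : Integrable g) (hsg : Integrable (fun l : ℝ => l * g l))
    (a b : ℝ)
    (ha : a = (1 / (2 * π)) * ∫ l : ℝ, g l)
    (hb : b = (1 / (2 * π)) * ∫ l : ℝ, l * g l)
    (u : ℝ)
    (F π₁ : ℂ → ℂ)
    (hF : ∀ l : ℂ, l.im < 0 →
      F l = (1 / (2 * (π : ℂ) * Complex.I)) * ∫ s : ℝ, (g s : ℂ) / ((s : ℂ) - l))
    (hπ₁ : ∀ l : ℂ, l.im < 0 →
      π₁ l = (l + 2 * (u : ℂ) + (a : ℂ)) * Complex.exp (Complex.I * F l)) :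
    Tendsto
      (fun t : ℝ => (-Complex.I * t) *
        (π₁ (-Complex.I * t) - (-Complex.I * t) - 2 * (u : ℂ)))
      atTop (nhds ((-2 * u * a - b - a ^ 2 / 2 : ℝ) : ℂ)) ∧
    ∀ w : ℂ,
      Tendsto
        (fun t : ℝ => (-Complex.I * t) *
          (π₁ (-Complex.I * t) - (-Complex.I * t) - 2 * (u : ℂ)))
        atTop (nhds (2 * w)) →
      w = ((-(u * a) - b / 2 - a ^ 2 / 4 : ℝ) : ℂ) := by
  have hpi : (π : ℂ) ≠ 0 := by exact_mod_cast Real.pi_ne_zero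
  have hFz : ∀ t : ℝ, 0 < t → Complex.I * F (-Complex.I * t) =
      (1 / (2 * (π : ℂ))) * ∫ s : ℝ, (g s : ℂ) / ((s : ℂ) - -Complex.I * t) := by
    intro t ht
    rw [hF _ (by rw [aux_im]; linarith), ← mul_assoc]
    congr 1
    have := Complex.I_ne_zero
    field_simp
  have main : Tendsto
      (fun t : ℝ => (-Complex.I * t) *
        (π₁ (-Complex.I * t) - (-Complex.I * t) - 2 * (u : ℂ)))
      atTop (nhds ((-2 * u * a - b - a ^ 2 / 2 : ℝ) : ℂ)) := by
    have hL : Tendsto (fun t : ℝ => (-Complex.I * (t : ℂ))⁻¹) atTop (nhds 0) := by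
      have h1 : Tendsto (fun t : ℝ => ((t⁻¹ : ℝ) : ℂ)) atTop (nhds ((0 : ℝ) : ℂ)) :=
        (Complex.continuous_ofReal.tendsto 0).comp tendsto_inv_atTop_zero
      have h2 := h1.const_mul (-Complex.I)⁻¹
      simpa [mul_inv, mul_comm] using h2
    have h1 := (aux_dct g hg).const_mul (1 / (2 * (π : ℂ)))
    have h2 := (aux_dct _ hsg).const_mul (1 / (2 * (π : ℂ)))
    have key := aux_exp
      (fun t => (1 / (2 * (π : ℂ))) * ∫ s : ℝ, (g s : ℂ) / ((s : ℂ) - -Complex.I * t))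
      (fun t => -Complex.I * t)
      (fun t => (1 / (2 * (π : ℂ))) *
        ∫ s : ℝ, ((s * g s : ℝ) : ℂ) / ((s : ℂ) - -Complex.I * t))
      a b u hL ?_ ?_ ?_ ?_
    · push_cast
      refine key.congr' ?_
      filter_upwards [eventually_gt_atTop 0] with t ht
      rw [hπ₁ _ (by rw [aux_im]; linarith), hFz t ht]
    · filter_upwards [eventually_gt_atTop 0] with t ht
      have ht' : (t : ℂ) ≠ 0 := by exact_mod_cast ht.ne'
      exact mul_ne_zero (neg_ne_zero.mpr Complex.I_ne_zero) ht'
    · have e : -(a : ℂ) = (1 / (2 * (π : ℂ))) * -((∫ s, g s : ℝ) : ℂ) := by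
        rw [ha]; push_cast; ring
      rw [e]
      exact h1.congr fun t => by ring
    · have e : -(b : ℂ) = (1 / (2 * (π : ℂ))) * -((∫ s, s * g s : ℝ) : ℂ) := by
        rw [hb, Complex.ofReal_mul]; push_cast; ring
      rw [e]
      exact h2.congr fun t => by ring
    · filter_upwards [eventually_gt_atTop 0] with t ht
      rw [← aux_id g hg hsg t ht, ha, Complex.ofReal_mul]
      push_cast
      ring
  refine ⟨main, fun w hw => ?_⟩
  have h := tendsto_nhds_unique hw main
  have h' : w = (2 * w) / 2 := by ring
  rw [h', h]
  push_cast
  ring
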